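/- The zero set S = {(q,z) ∈ 𝔻₁ × ℂ : θ(q,z) = 0} of the partial theta function is smooth (a one-dimensional complex submanifold) at every point (q♭,z♭) such that z♭ is a simple or double zero of θ(q♭,·). -/

import Mathlib

/-- The partial theta function θ(q,z) = ∑_{j=0}^∞ q^{j(j+1)/2} z^j. -/
noncomputable def partialTheta (q z : ℂ) : ℂ := ∑' j : ℕ, q ^ (j * (j + 1) / 2) * z ^ j

open Filter Topology

namespace PTheta

lemma two_mul_tri (j : ℕ) : 2 * (j * (j + 1) / 2) = j * (j + 1) :=
  Nat.mul_div_cancel' (Nat.even_mul_succ_self j).two_dvd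

lemma tri_succ (j : ℕ) : (j + 1) * (j + 1 + 1) / 2 = j * (j + 1) / 2 + (j + 1) := by
  have h1 := two_mul_tri j
  have h2 := two_mul_tri (j + 1)
  nlinarith

/-- The common summable majorant. -/
noncomputable def maj (r R : ℝ) (j : ℕ) : ℝ :=
  (2 / r) * ((j : ℝ) + 1) ^ 2 * (r ^ (j * (j + 1) / 2) * R ^ j)

lemma summable_maj {r R : ℝ} (hr : 0 < r) (hr1 : r < 1) (hR : 0 < R) : Summable (maj r R) := by
  refine summable_of_ratio_norm_eventually_le (r := 1 / 2) (by norm_num) ?_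
  have ht : Tendsto (fun j : ℕ => 4 * (r ^ (j + 1) * R)) atTop (𝓝 (4 * (0 * R))) :=
    (((tendsto_pow_atTop_nhds_zero_of_lt_one hr.le hr1).comp (tendsto_add_atTop_nat 1)).mul_const
      R).const_mul 4
  have hev := ht.eventually (gt_mem_nhds (show 4 * (0 * R) < 1 / 2 by norm_num))
  filter_upwards [hev] with j hj
  have hpos : ∀ j, 0 ≤ maj r R j := fun j => by unfold maj; positivity
  rw [Real.norm_of_nonneg (hpos _), Real.norm_of_nonneg (hpos _)]
  unfold maj
  rw [tri_succ, pow_add, pow_succ R]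
  push_cast
  have h4 : ((j : ℝ) + 1 + 1) ^ 2 ≤ 4 * ((j : ℝ) + 1) ^ 2 := by
    have : (0 : ℝ) ≤ j := Nat.cast_nonneg j
    nlinarith
  set X := r ^ (j * (j + 1) / 2) * R ^ j with hX
  have hX0 : 0 ≤ X := by positivity
  set Y := r ^ (j + 1) * R with hY
  have hY0 : 0 ≤ Y := by positivity
  calc 2 / r * ((j : ℝ) + 1 + 1) ^ 2 * (r ^ (j * (j + 1) / 2) * r ^ (j + 1) * (R ^ j * R))
      = 2 / r * ((j : ℝ) + 1 + 1) ^ 2 * (X * Y) := by rw [hX, hY]; ring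
    _ ≤ 2 / r * (4 * ((j : ℝ) + 1) ^ 2) * (X * Y) := by gcongr
    _ = (4 * Y) * (2 / r * ((j : ℝ) + 1) ^ 2 * X) := by ring
    _ ≤ 1 / 2 * (2 / r * ((j : ℝ) + 1) ^ 2 * X) := by gcongr

/-- A monomial bound: the exponents may drop by one in `q` and by anything in `z`. -/
lemma mono_bound {r R : ℝ} (hr : 0 < r) (hr1 : r < 1) (hR : 1 ≤ R) {q z : ℂ}
    (hq : ‖q‖ ≤ r) (hz : ‖z‖ ≤ R) (j m k : ℕ) (hm : j * (j + 1) / 2 ≤ m + 1) (hk : k ≤ j)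
    (c : ℂ) (hc : ‖c‖ ≤ ((j : ℝ) + 1) ^ 2) :
    ‖c * (q ^ m * z ^ k)‖ ≤ maj r R j / 2 := by
  rw [norm_mul, norm_mul, norm_pow, norm_pow]
  have h1 : ‖q‖ ^ m ≤ r ^ (j * (j + 1) / 2) / r := by
    rw [le_div_iff₀ hr]
    calc ‖q‖ ^ m * r ≤ r ^ m * r := by gcongr
      _ = r ^ (m + 1) := (pow_succ r m).symm
      _ ≤ _ := pow_le_pow_of_le_one hr.le hr1.le hm
  have h2 : ‖z‖ ^ k ≤ R ^ j := by
    calc ‖z‖ ^ k ≤ R ^ k := by gcongr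
      _ ≤ R ^ j := pow_le_pow_right₀ hR hk
  calc ‖c‖ * (‖q‖ ^ m * ‖z‖ ^ k) ≤ ((j : ℝ) + 1) ^ 2 * (r ^ (j * (j + 1) / 2) / r * R ^ j) := by
        gcongr
    _ = maj r R j / 2 := by unfold maj; field_simp

lemma cast_tri (j : ℕ) : (2 : ℂ) * ((j * (j + 1) / 2 : ℕ) : ℂ) = j * (j + 1) := by
  exact_mod_cast two_mul_tri j

lemma cq_bound (j : ℕ) : ‖((j * (j + 1) / 2 : ℕ) : ℂ)‖ ≤ ((j : ℝ) + 1) ^ 2 := by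
  rw [Complex.norm_natCast]
  have h : j * (j + 1) / 2 ≤ (j + 1) ^ 2 := by
    have := two_mul_tri j
    nlinarith
  exact_mod_cast h

lemma cz_bound (j : ℕ) : ‖(j : ℂ)‖ ≤ ((j : ℝ) + 1) ^ 2 := by
  rw [Complex.norm_natCast]
  nlinarith [Nat.cast_nonneg (α := ℝ) j]

lemma czz_bound (j : ℕ) : ‖(j : ℂ) * ((j - 1 : ℕ) : ℂ)‖ ≤ ((j : ℝ) + 1) ^ 2 := by
  rw [norm_mul, Complex.norm_natCast, Complex.norm_natCast]
  have h : j * (j - 1) ≤ (j + 1) ^ 2 := by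
    have : j - 1 ≤ j := Nat.sub_le _ _
    nlinarith
  exact_mod_cast h

/-- Derivative of the `j`-th term. -/
noncomputable def tder (j : ℕ) (p : ℂ × ℂ) : ℂ × ℂ →L[ℂ] ℂ :=
  (((j * (j + 1) / 2 : ℕ) : ℂ) * (p.1 ^ (j * (j + 1) / 2 - 1) * p.2 ^ j)) •
      ContinuousLinearMap.fst ℂ ℂ ℂ +
    ((j : ℂ) * (p.1 ^ (j * (j + 1) / 2) * p.2 ^ (j - 1))) • ContinuousLinearMap.snd ℂ ℂ ℂ

lemma hasFDerivAt_term (j : ℕ) (p : ℂ × ℂ) :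
    HasFDerivAt (fun p : ℂ × ℂ => p.1 ^ (j * (j + 1) / 2) * p.2 ^ j) (tder j p) p := by
  have h1 := (hasFDerivAt_fst (𝕜 := ℂ) (p := p)).pow (j * (j + 1) / 2)
  have h2 := (hasFDerivAt_snd (𝕜 := ℂ) (p := p)).pow j
  refine (h1.mul h2).congr_fderiv ?_
  ext <;> simp [tder] <;> ring

lemma tder_bound {r R : ℝ} (hr : 0 < r) (hr1 : r < 1) (hR : 1 ≤ R) {p : ℂ × ℂ}
    (hq : ‖p.1‖ ≤ r) (hz : ‖p.2‖ ≤ R) (j : ℕ) : ‖tder j p‖ ≤ maj r R j := by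
  have hA := mono_bound hr hr1 hR hq hz j (j * (j + 1) / 2 - 1) j (by omega) le_rfl _ (cq_bound j)
  have hB := mono_bound hr hr1 hR hq hz j (j * (j + 1) / 2) (j - 1) (by omega) (by omega) _
    (cz_bound j)
  have h1 := ContinuousLinearMap.norm_fst_le ℂ ℂ ℂ
  have h2 := ContinuousLinearMap.norm_snd_le ℂ ℂ ℂ
  unfold tder
  refine (norm_add_le _ _).trans ?_
  rw [norm_smul, norm_smul]
  have := mul_le_mul hA h1 (norm_nonneg _) ((norm_nonneg _).trans hA)
  have := mul_le_mul hB h2 (norm_nonneg _) ((norm_nonneg _).trans hB)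
  linarith

lemma continuous_tder (j : ℕ) : Continuous (tder j) := by
  unfold tder
  fun_prop

lemma summable_zero : Summable fun j : ℕ => (0 : ℂ) ^ (j * (j + 1) / 2) * (0 : ℂ) ^ j := by
  refine summable_of_ne_finset_zero (s := {0}) ?_
  intro j hj
  have : j ≠ 0 := by simpa using hj
  simp [this]

lemma theta_zero (q : ℂ) : partialTheta q 0 = 1 := by
  unfold partialTheta
  rw [tsum_eq_single 0]
  · simp
  · intro j hj
    simp [hj]

lemma hasFDerivAt_theta {r R : ℝ} (hr : 0 < r) (hr1 : r < 1) (hR : 1 ≤ R)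
    {p : ℂ × ℂ} (hq : ‖p.1‖ < r) (hz : ‖p.2‖ < R) :
    HasFDerivAt (fun p : ℂ × ℂ => partialTheta p.1 p.2) (∑' j, tder j p) p := by
  have hR0 : 0 < R := by linarith
  refine hasFDerivAt_tsum_of_isPreconnected (u := maj r R)
    (s := Metric.ball (0 : ℂ) r ×ˢ Metric.ball (0 : ℂ) R) (x₀ := (0, 0))
    (f := fun j (p : ℂ × ℂ) => p.1 ^ (j * (j + 1) / 2) * p.2 ^ j)
    (summable_maj hr hr1 hR0) (Metric.isOpen_ball.prod Metric.isOpen_ball)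
    ((convex_ball (0 : ℂ) r).prod (convex_ball (0 : ℂ) R)).isPreconnected
    (fun j p _ => hasFDerivAt_term j p) ?_ ?_ ?_ ?_
  · rintro j p ⟨h1, h2⟩
    exact tder_bound hr hr1 hR (mem_ball_zero_iff.1 h1).le (mem_ball_zero_iff.1 h2).le j
  · exact ⟨Metric.mem_ball_self hr, Metric.mem_ball_self hR0⟩
  · exact summable_zero
  · exact ⟨mem_ball_zero_iff.2 hq, mem_ball_zero_iff.2 hz⟩

lemma contDiffAt_theta {r R : ℝ} (hr : 0 < r) (hr1 : r < 1) (hR : 1 ≤ R)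
    {p : ℂ × ℂ} (hq : ‖p.1‖ < r) (hz : ‖p.2‖ < R) :
    ContDiffAt ℂ 1 (fun p : ℂ × ℂ => partialTheta p.1 p.2) p := by
  have hR0 : 0 < R := by linarith
  rw [contDiffAt_one_iff]
  refine ⟨fun p => ∑' j, tder j p, Metric.ball (0 : ℂ) r ×ˢ Metric.ball (0 : ℂ) R,
    (Metric.isOpen_ball.prod Metric.isOpen_ball).mem_nhds
      ⟨mem_ball_zero_iff.2 hq, mem_ball_zero_iff.2 hz⟩,
    continuousOn_tsum (fun j => (continuous_tder j).continuousOn) (summable_maj hr hr1 hR0) ?_, ?_⟩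
  · rintro j p ⟨h1, h2⟩
    exact tder_bound hr hr1 hR (mem_ball_zero_iff.1 h1).le (mem_ball_zero_iff.1 h2).le j
  · rintro p ⟨h1, h2⟩
    exact hasFDerivAt_theta hr hr1 hR (mem_ball_zero_iff.1 h1) (mem_ball_zero_iff.1 h2)

lemma summable_tder {r R : ℝ} (hr : 0 < r) (hr1 : r < 1) (hR : 1 ≤ R)
    {p : ℂ × ℂ} (hq : ‖p.1‖ < r) (hz : ‖p.2‖ < R) :
    Summable fun j => tder j p :=
  .of_norm_bounded (summable_maj hr hr1 (by linarith))
    fun j => tder_bound hr hr1 hR hq.le hz.le j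

/-- The `q`-derivative. -/
lemma hasDerivAt_q {r R : ℝ} (hr : 0 < r) (hr1 : r < 1) (hR : 1 ≤ R)
    {q z : ℂ} (hq : ‖q‖ < r) (hz : ‖z‖ < R) :
    HasDerivAt (fun t => partialTheta t z) ((∑' j, tder j (q, z)) (1, 0)) q := by
  have h := hasFDerivAt_theta hr hr1 hR (p := (q, z)) hq hz
  exact h.comp_hasDerivAt q ((hasDerivAt_id q).prodMk (hasDerivAt_const q z))

lemma hasDerivAt_z {r R : ℝ} (hr : 0 < r) (hr1 : r < 1) (hR : 1 ≤ R)
    {q z : ℂ} (hq : ‖q‖ < r) (hz : ‖z‖ < R) :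
    HasDerivAt (fun t => partialTheta q t) ((∑' j, tder j (q, z)) (0, 1)) z := by
  have h := hasFDerivAt_theta hr hr1 hR (p := (q, z)) hq hz
  exact h.comp_hasDerivAt z ((hasDerivAt_const z q).prodMk (hasDerivAt_id z))

lemma hasSum_q {r R : ℝ} (hr : 0 < r) (hr1 : r < 1) (hR : 1 ≤ R)
    {q z : ℂ} (hq : ‖q‖ < r) (hz : ‖z‖ < R) :
    HasSum (fun j : ℕ => ((j * (j + 1) / 2 : ℕ) : ℂ) * (q ^ (j * (j + 1) / 2 - 1) * z ^ j))
      ((∑' j, tder j (q, z)) (1, 0)) := by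
  have h := (summable_tder hr hr1 hR (p := (q, z)) hq hz).hasSum.mapL
    (ContinuousLinearMap.apply ℂ ℂ ((1, 0) : ℂ × ℂ))
  simpa [tder] using h

lemma hasSum_z {r R : ℝ} (hr : 0 < r) (hr1 : r < 1) (hR : 1 ≤ R)
    {q z : ℂ} (hq : ‖q‖ < r) (hz : ‖z‖ < R) :
    HasSum (fun j : ℕ => (j : ℂ) * (q ^ (j * (j + 1) / 2) * z ^ (j - 1)))
      ((∑' j, tder j (q, z)) (0, 1)) := by
  have h := (summable_tder hr hr1 hR (p := (q, z)) hq hz).hasSum.mapL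
    (ContinuousLinearMap.apply ℂ ℂ ((0, 1) : ℂ × ℂ))
  simpa [tder] using h

lemma hasSum_zz {r R : ℝ} (hr : 0 < r) (hr1 : r < 1) (hR : 1 ≤ R)
    {q z : ℂ} (hq : ‖q‖ < r) (hz : ‖z‖ < R) :
    HasSum (fun j : ℕ => ((j : ℂ) * ((j - 1 : ℕ) : ℂ)) * (q ^ (j * (j + 1) / 2) * z ^ (j - 1 - 1)))
      (deriv (deriv (fun w : ℂ => partialTheta q w)) z) := by
  have hR0 : 0 < R := by linarith
  have hmem : z ∈ Metric.ball (0 : ℂ) R := mem_ball_zero_iff.2 hz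
  have hev : deriv (fun w : ℂ => partialTheta q w) =ᶠ[𝓝 z]
      fun w => ∑' j : ℕ, (j : ℂ) * (q ^ (j * (j + 1) / 2) * w ^ (j - 1)) := by
    filter_upwards [Metric.isOpen_ball.mem_nhds hmem] with w hw
    have hw' := mem_ball_zero_iff.1 hw
    rw [(hasDerivAt_z hr hr1 hR hq hw').deriv, (hasSum_z hr hr1 hR hq hw').tsum_eq]
  rw [hev.deriv_eq]
  have h := Complex.hasSum_deriv_of_summable_norm (u := fun j => maj r R j / 2)
    (F := fun (j : ℕ) w => (j : ℂ) * (q ^ (j * (j + 1) / 2) * w ^ (j - 1)))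
    ((summable_maj hr hr1 hR0).div_const 2)
    (fun j => by fun_prop) Metric.isOpen_ball
    (fun j w hw => mono_bound hr hr1 hR hq.le (mem_ball_zero_iff.1 hw).le j _ _ (by omega)
      (by omega) _ (cz_bound j)) hmem
  refine h.congr_fun ?_
  intro j
  simp
  ring

lemma heat {r R : ℝ} (hr : 0 < r) (hr1 : r < 1) (hR : 1 ≤ R)
    {q z : ℂ} (hq : ‖q‖ < r) (hz : ‖z‖ < R) :
    2 * q * ((∑' j, tder j (q, z)) (1, 0)) = 2 * z * ((∑' j, tder j (q, z)) (0, 1)) +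
      z ^ 2 * deriv (deriv (fun w : ℂ => partialTheta q w)) z := by
  have h1 := (hasSum_q hr hr1 hR hq hz).mul_left (2 * q)
  have h2 := ((hasSum_z hr hr1 hR hq hz).mul_left (2 * z)).add
    ((hasSum_zz hr hr1 hR hq hz).mul_left (z ^ 2))
  refine h1.unique (h2.congr_fun ?_)
  intro j
  have hc := cast_tri j
  have e1 : 2 * q * (((j * (j + 1) / 2 : ℕ) : ℂ) * (q ^ (j * (j + 1) / 2 - 1) * z ^ j)) =
      (j * (j + 1)) * (q ^ (j * (j + 1) / 2) * z ^ j) := by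
    rw [← hc]
    rcases Nat.eq_zero_or_pos (j * (j + 1) / 2) with h | h
    · rw [h]; simp
    · obtain ⟨m, hm⟩ := Nat.exists_eq_succ_of_ne_zero h.ne'
      rw [hm, Nat.succ_eq_add_one, Nat.add_sub_cancel, pow_succ]
      ring
  rw [e1]
  rcases j with _ | _ | j
  · simp
  · simp; ring
  · simp only [Nat.add_sub_cancel]
    push_cast
    ring

/-- Implicit function theorem in the form we need. -/
lemma implicit {f : ℂ × ℂ → ℂ} {a b B : ℂ} (hf : ContDiffAt ℂ 1 f (a, b)) (h0 : f (a, b) = 0)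
    (hB : HasDerivAt (fun y => f (a, y)) B b) (hB0 : B ≠ 0) :
    ∃ g : ℂ → ℂ, AnalyticAt ℂ g a ∧ g a = b ∧
      ∀ᶠ p : ℂ × ℂ in 𝓝 (a, b), (f p = 0 ↔ p.2 = g p.1) := by
  have hd : HasFDerivAt f (fderiv ℂ f (a, b)) (a, b) :=
    (hf.differentiableAt one_ne_zero).hasFDerivAt
  have hB' : fderiv ℂ f (a, b) (0, 1) = B :=
    HasDerivAt.unique
      (hd.comp_hasDerivAt b ((hasDerivAt_const b a).prodMk (hasDerivAt_id b))) hB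
  have key : ∀ y : ℂ, fderiv ℂ f (a, b) (0, y) = y * B := by
    intro y
    have : ((0, y) : ℂ × ℂ) = y • ((0, 1) : ℂ × ℂ) := by simp
    rw [this, map_smul, hB', smul_eq_mul]
  have hinv : (fderiv ℂ f (a, b) ∘L .inr ℂ ℂ ℂ).IsInvertible := by
    refine ContinuousLinearMap.IsInvertible.of_inverse (g := B⁻¹ • .id ℂ ℂ) ?_ ?_
    · ext
      simp [key, hB0]
    · ext
      simp [key, hB0]
  refine ⟨hf.implicitFunction one_ne_zero hinv, ?_, hf.implicitFunction_apply_self one_ne_zero hinv,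
    ?_⟩
  · rw [Complex.analyticAt_iff_eventually_differentiableAt]
    have := hf.contDiffAt_implicitFunction one_ne_zero hinv
    filter_upwards [this.eventually (by simp)] with x hx
    exact hx.differentiableAt one_ne_zero
  · filter_upwards [hf.eventually_apply_eq_iff_implicitFunction one_ne_zero hinv] with p hp
    rw [h0] at hp
    rw [hp, eq_comm]

end PTheta

/-- The zero set S of the partial theta function is smooth (locally the graph of an
analytic function, i.e. a one-dimensional complex submanifold) at every point
`(q♭, z♭)` such that `z♭` is a simple or double zero of `θ(q♭, ·)`. -/
theorem partialTheta_zero_set_smooth (q z : ℂ) (hq : ‖q‖ < 1)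
    (h0 : partialTheta q z = 0)
    (h : deriv (fun w : ℂ => partialTheta q w) z ≠ 0 ∨
        (deriv (fun w : ℂ => partialTheta q w) z = 0 ∧
         deriv (deriv (fun w : ℂ => partialTheta q w)) z ≠ 0)) :
    (∃ f : ℂ → ℂ, AnalyticAt ℂ f q ∧ f q = z ∧
      ∀ᶠ p : ℂ × ℂ in nhds (q, z), (partialTheta p.1 p.2 = 0 ↔ p.2 = f p.1)) ∨
    (∃ g : ℂ → ℂ, AnalyticAt ℂ g z ∧ g z = q ∧
      ∀ᶠ p : ℂ × ℂ in nhds (q, z), (partialTheta p.1 p.2 = 0 ↔ p.1 = g p.2)) := by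
  obtain ⟨r, hr1, hr2⟩ := exists_between hq
  have hr : 0 < r := (norm_nonneg q).trans_lt hr1
  have hR : 1 ≤ ‖z‖ + 1 := by linarith [norm_nonneg z]
  have hz : ‖z‖ < ‖z‖ + 1 := by linarith
  have hcd := PTheta.contDiffAt_theta hr hr2 hR (p := (q, z)) hr1 hz
  have hdz := PTheta.hasDerivAt_z hr hr2 hR hr1 hz
  rcases h with h | ⟨h1, h2⟩
  · left
    exact PTheta.implicit hcd h0 (hdz.differentiableAt.hasDerivAt) h
  · right
    have hz0 : z ≠ 0 := by
      rintro rfl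
      rw [PTheta.theta_zero] at h0
      exact one_ne_zero h0
    have hheat := PTheta.heat hr hr2 hR hr1 hz
    rw [← hdz.deriv, h1, mul_zero, zero_add] at hheat
    have hA : (∑' j, PTheta.tder j (q, z)) (1, 0) ≠ 0 := by
      intro hA
      rw [hA, mul_zero] at hheat
      exact mul_ne_zero (pow_ne_zero 2 hz0) h2 hheat.symm
    have hcd' : ContDiffAt ℂ 1 (fun p : ℂ × ℂ => partialTheta p.2 p.1) (z, q) :=
      ContDiffAt.comp (g := fun p : ℂ × ℂ => partialTheta p.1 p.2)
        (f := fun p : ℂ × ℂ => (p.2, p.1)) (z, q) hcd (contDiffAt_snd.prodMk contDiffAt_fst)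
    obtain ⟨g, hg, hgz, hev⟩ :=
      PTheta.implicit hcd' h0 (PTheta.hasDerivAt_q hr hr2 hR hr1 hz) hA
    refine ⟨g, hg, hgz, ?_⟩
    have hsw : Tendsto (fun p : ℂ × ℂ => (p.2, p.1)) (𝓝 (q, z)) (𝓝 (z, q)) :=
      (continuous_snd.prodMk continuous_fst).tendsto (q, z)
    exact hsw.eventually hev
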